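/- For any prime p, the limit σ_p = lim_{n→∞} 𝔠₂(ℤ/pⁿℤ)/p^{6n} exists and equals (1 + 1/p)·(1 − 1/p²)^{-1}·(1 − 1/p³). -/

import Mathlib

/-- The number of pairs `(A,B)` of `2 × 2` matrices over `ZMod q` such that
`A * B = B * A`. -/
noncomputable def matCommCountZMod (q : ℕ) : ℕ :=
  Nat.card {AB : Matrix (Fin 2) (Fin 2) (ZMod q) × Matrix (Fin 2) (Fin 2) (ZMod q) //
    AB.1 * AB.2 = AB.2 * AB.1}

namespace CommutingTwoByTwo

/-- Two vectors are parallel if all their `2 × 2` minors vanish. -/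
def Parallel {ι R : Type*} [Mul R] (u v : ι → R) : Prop :=
  ∀ i j, u i * v j = u j * v i

/-- The number of pairs of parallel vectors in `(ZMod q)³`. -/
noncomputable def parallelCount (q : ℕ) : ℕ :=
  Nat.card {x : (Fin 3 → ZMod q) × (Fin 3 → ZMod q) // Parallel x.1 x.2}

theorem matrix_commute_iff_parallel {R : Type*} [CommRing R] (A B : Matrix (Fin 2) (Fin 2) R) :
    A * B = B * A ↔
      Parallel ![A 0 0 - A 1 1, A 0 1, A 1 0] ![B 0 0 - B 1 1, B 0 1, B 1 0] := by
  rw [← Matrix.ext_iff]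
  simp only [Parallel, Fin.forall_fin_succ, Matrix.mul_apply, Fin.sum_univ_two]
  simp only [Fin.isValue, Fin.succ_zero_eq_one, Matrix.cons_val_zero, Matrix.cons_val_one,
    Matrix.cons_val_succ, IsEmpty.forall_iff, and_true]
  grind

/-- A `2 × 2` matrix is determined by its last entry and by the class modulo scalars. -/
def matrixEquiv (R : Type*) [CommRing R] : Matrix (Fin 2) (Fin 2) R ≃ R × (Fin 3 → R) where
  toFun A := (A 1 1, ![A 0 0 - A 1 1, A 0 1, A 1 0])
  invFun x := !![x.2 0 + x.1, x.2 1; x.2 2, x.1]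
  left_inv A := by ext i j; fin_cases i <;> fin_cases j <;> simp
  right_inv x := by
    refine Prod.ext (by simp) ?_
    ext i; fin_cases i <;> simp

theorem matCommCountZMod_eq (q : ℕ) : matCommCountZMod q = q ^ 2 * parallelCount q := by
  let e : {AB : Matrix (Fin 2) (Fin 2) (ZMod q) × Matrix (Fin 2) (Fin 2) (ZMod q) //
      AB.1 * AB.2 = AB.2 * AB.1} ≃
      (ZMod q × ZMod q) × {x : (Fin 3 → ZMod q) × (Fin 3 → ZMod q) // Parallel x.1 x.2} :=
    { toFun := fun x => ⟨(x.1.1 1 1, x.1.2 1 1),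
        ⟨((matrixEquiv _ x.1.1).2, (matrixEquiv _ x.1.2).2),
          (matrix_commute_iff_parallel _ _).1 x.2⟩⟩
      invFun := fun y => ⟨((matrixEquiv _).symm (y.1.1, y.2.1.1),
          (matrixEquiv _).symm (y.1.2, y.2.1.2)), by
        refine (matrix_commute_iff_parallel _ _).2 ?_
        have h := y.2.2
        have h1 := congrArg Prod.snd ((matrixEquiv (ZMod q)).apply_symm_apply (y.1.1, y.2.1.1))
        have h2 := congrArg Prod.snd ((matrixEquiv (ZMod q)).apply_symm_apply (y.1.2, y.2.1.2))
        change _ = y.2.1.1 at h1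
        change _ = y.2.1.2 at h2
        rw [← h1, ← h2] at h
        exact h⟩
      left_inv := fun x => Subtype.ext (Prod.ext ((matrixEquiv _).symm_apply_apply x.1.1)
        ((matrixEquiv _).symm_apply_apply x.1.2))
      right_inv := fun y => by
        have h1 := (matrixEquiv (ZMod q)).apply_symm_apply (y.1.1, y.2.1.1)
        have h2 := (matrixEquiv (ZMod q)).apply_symm_apply (y.1.2, y.2.1.2)
        have h3 := congrArg Prod.fst h1
        have h4 := congrArg Prod.snd h1
        have h5 := congrArg Prod.fst h2
        have h6 := congrArg Prod.snd h2
        exact Prod.ext (Prod.ext h3 h5) (Subtype.ext (Prod.ext h4 h6)) }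
  rw [matCommCountZMod, Nat.card_congr e, Nat.card_prod, Nat.card_prod, Nat.card_zmod,
    parallelCount, sq]

theorem card_parallel_of_isUnit {ι R : Type*} [CommRing R] {u : ι → R} {i : ι}
    (hi : IsUnit (u i)) : Nat.card {v // Parallel u v} = Nat.card R := by
  refine (Nat.card_congr (Equiv.ofBijective
    (fun c : R => (⟨fun j => c * u j, fun j k => by ring⟩ : {v // Parallel u v})) ⟨?_, ?_⟩)).symm
  · intro a b h
    exact hi.mul_right_cancel (congrFun (congrArg Subtype.val h) i)
  · rintro ⟨v, hv⟩
    obtain ⟨w, hw⟩ := hi.exists_right_inv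
    refine ⟨v i * w, Subtype.ext (funext fun j => ?_)⟩
    have := hv i j
    change v i * w * u j = v j
    linear_combination (-w) * this + v j * hw

section Reduction

variable (p n : ℕ)

/-- Reduction from `ZMod (p ^ (n + 1))` to `ZMod (p ^ n)`. -/
def reduction : ZMod (p ^ (n + 1)) →+* ZMod (p ^ n) :=
  ZMod.castHom (pow_dvd_pow p n.le_succ) _

/-- Multiplication by `p`, as a map from `ZMod (p ^ n)` to `ZMod (p ^ (n + 1))`. -/
def mulPrime (s : ZMod (p ^ n)) : ZMod (p ^ (n + 1)) := p * (s.val : ZMod (p ^ (n + 1)))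

variable {p n}

theorem prime_mul_eq_zero_iff (hp : p.Prime) (z : ZMod (p ^ (n + 1))) :
    (p : ZMod (p ^ (n + 1))) * z = 0 ↔ reduction p n z = 0 := by
  obtain ⟨k, rfl⟩ := ZMod.intCast_surjective z
  rw [map_intCast, ZMod.intCast_zmod_eq_zero_iff_dvd, ← Int.cast_natCast (R := ZMod (p ^ (n + 1))),
    ← Int.cast_mul, ZMod.intCast_zmod_eq_zero_iff_dvd]
  push_cast
  rw [pow_succ', mul_dvd_mul_iff_left (by exact_mod_cast hp.ne_zero)]

theorem reduction_val (hp : p.Prime) (s : ZMod (p ^ n)) :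
    reduction p n (s.val : ZMod (p ^ (n + 1))) = s := by
  have : NeZero (p ^ n) := ⟨pow_ne_zero _ hp.ne_zero⟩
  rw [map_natCast, ZMod.natCast_zmod_val]

theorem mulPrime_reduction (hp : p.Prime) (x : ZMod (p ^ (n + 1))) :
    mulPrime p n (reduction p n x) = p * x := by
  rw [mulPrime, ← sub_eq_zero, ← mul_sub, prime_mul_eq_zero_iff hp, map_sub, reduction_val hp,
    sub_self]

theorem mulPrime_mul_eq_iff (hp : p.Prime) (s t : ZMod (p ^ n)) (x y : ZMod (p ^ (n + 1))) :
    mulPrime p n s * x = mulPrime p n t * y ↔ s * reduction p n x = t * reduction p n y := by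
  rw [← sub_eq_zero, mulPrime, mulPrime, mul_assoc, mul_assoc, ← mul_sub,
    prime_mul_eq_zero_iff hp, map_sub, map_mul, map_mul, reduction_val hp, reduction_val hp,
    sub_eq_zero]

theorem mulPrime_injective (hp : p.Prime) : Function.Injective (mulPrime p n) := by
  intro s t h
  simpa using (mulPrime_mul_eq_iff hp s t 1 1).1 (by simpa using h)

theorem not_isUnit_iff (hp : p.Prime) (x : ZMod (p ^ (n + 1))) :
    ¬ IsUnit x ↔ ∃ s, mulPrime p n s = x := by
  have : NeZero (p ^ (n + 1)) := ⟨pow_ne_zero _ hp.ne_zero⟩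
  obtain ⟨k, rfl⟩ := ZMod.natCast_zmod_surjective x
  have hk : ¬ IsUnit (k : ZMod (p ^ (n + 1))) ↔ p ∣ k := by
    rw [ZMod.isUnit_iff_coprime, Nat.coprime_pow_right_iff n.succ_pos, Nat.coprime_comm,
      hp.dvd_iff_not_coprime]
  constructor
  · intro h
    obtain ⟨m, rfl⟩ := hk.1 h
    exact ⟨reduction p n m, by rw [mulPrime_reduction hp]; push_cast; rfl⟩
  · rintro ⟨s, hs⟩ h
    rw [← hs, mulPrime] at h
    have h' := isUnit_of_mul_isUnit_left h
    rw [ZMod.isUnit_iff_coprime, Nat.coprime_pow_right_iff n.succ_pos, Nat.coprime_self] at h'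
    exact hp.one_lt.ne' h'

theorem exists_equiv_prod (hp : p.Prime) :
    ∃ e : ZMod (p ^ (n + 1)) ≃ ZMod (p ^ n) × Fin p, ∀ x, (e x).1 = reduction p n x := by
  have : NeZero (p ^ (n + 1)) := ⟨pow_ne_zero _ hp.ne_zero⟩
  have : NeZero (p ^ n) := ⟨pow_ne_zero _ hp.ne_zero⟩
  let g : ZMod (p ^ n) × Fin p → ZMod (p ^ (n + 1)) :=
    fun y => ((y.1.val + p ^ n * y.2 : ℕ) : ZMod (p ^ (n + 1)))
  have hred : ∀ y, reduction p n (g y) = y.1 := by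
    intro y
    simp only [g, map_natCast]
    rw [Nat.cast_add, Nat.cast_mul, ZMod.natCast_self, zero_mul, add_zero, ZMod.natCast_zmod_val]
  have hinj : Function.Injective g := by
    rintro ⟨s, i⟩ ⟨t, j⟩ h
    obtain rfl : s = t := by simpa [hred] using congrArg (reduction p n) h
    simp only [g] at h
    rw [ZMod.natCast_eq_natCast_iff] at h
    have h1 := Nat.ModEq.add_left_cancel' _ h
    rw [pow_succ] at h1
    have h2 := Nat.ModEq.mul_left_cancel' (pow_ne_zero n hp.ne_zero) h1
    exact Prod.ext rfl (Fin.ext (h2.eq_of_lt_of_lt i.2 j.2))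
  have hbij : Function.Bijective g := (Fintype.bijective_iff_injective_and_card g).2
    ⟨hinj, by simp [ZMod.card, pow_succ]⟩
  refine ⟨(Equiv.ofBijective g hbij).symm, fun x => ?_⟩
  obtain ⟨y, rfl⟩ := hbij.2 x
  rw [Equiv.ofBijective_symm_apply_apply, hred]

theorem card_reduction_preimage (hp : p.Prime) (P : (Fin 3 → ZMod (p ^ n)) → Prop) :
    Nat.card {v : Fin 3 → ZMod (p ^ (n + 1)) // P (reduction p n ∘ v)} =
      p ^ 3 * Nat.card {w // P w} := by
  obtain ⟨e, he⟩ := exists_equiv_prod (n := n) hp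
  let E : (Fin 3 → ZMod (p ^ (n + 1))) ≃ (Fin 3 → ZMod (p ^ n)) × (Fin 3 → Fin p) :=
    (Equiv.arrowCongr (Equiv.refl _) e).trans (Equiv.arrowProdEquivProdArrow _ _ _)
  have hE : ∀ v, (E v).1 = reduction p n ∘ v := fun v => funext fun i => he (v i)
  have e1 : {v : Fin 3 → ZMod (p ^ (n + 1)) // P (reduction p n ∘ v)} ≃
      {y : (Fin 3 → ZMod (p ^ n)) × (Fin 3 → Fin p) // P y.1 ∧ True} :=
    E.subtypeEquiv fun v => by rw [hE, and_true]
  rw [Nat.card_congr (e1.trans (Equiv.subtypeProdEquivProd (q := fun _ => True))), Nat.card_prod,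
    Nat.card_congr (Equiv.subtypeUnivEquiv fun _ => trivial)]
  simp [mul_comm]

theorem parallelCount_succ (hp : p.Prime) :
    parallelCount (p ^ (n + 1)) + p ^ (n + 1) * p ^ (3 * n) =
      p ^ (n + 1) * p ^ (3 * (n + 1)) + p ^ 3 * parallelCount (p ^ n) := by
  classical
  have : NeZero (p ^ (n + 1)) := ⟨pow_ne_zero _ hp.ne_zero⟩
  have : NeZero (p ^ n) := ⟨pow_ne_zero _ hp.ne_zero⟩
  have hsum : ∀ q : ℕ, [NeZero q] →
      parallelCount q = ∑ u : Fin 3 → ZMod q, Nat.card {v // Parallel u v} := by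
    intro q _
    rw [parallelCount, Nat.card_congr (Equiv.subtypeProdEquivSigmaSubtype Parallel), Nat.card_sigma]
  let F : (Fin 3 → ZMod (p ^ n)) ↪ (Fin 3 → ZMod (p ^ (n + 1))) :=
    ⟨fun u => mulPrime p n ∘ u, (mulPrime_injective hp).comp_left⟩
  have hF : ∀ u : Fin 3 → ZMod (p ^ (n + 1)),
      u ∈ Finset.univ.map F ↔ ¬ ∃ i, IsUnit (u i) := by
    intro u
    simp only [Finset.mem_map, Finset.mem_univ, true_and, not_exists, not_isUnit_iff hp]
    constructor
    · rintro ⟨s, rfl⟩ i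
      exact ⟨s i, rfl⟩
    · intro h
      choose s hs using h
      exact ⟨s, funext hs⟩
  have hnon : ∑ u ∈ Finset.univ.map F, Nat.card {v // Parallel u v} =
      p ^ 3 * parallelCount (p ^ n) := by
    rw [Finset.sum_map, hsum, Finset.mul_sum]
    refine Finset.sum_congr rfl fun u _ => ?_
    rw [← card_reduction_preimage hp]
    exact Nat.card_congr (Equiv.subtypeEquivRight fun v =>
      forall₂_congr fun i j => mulPrime_mul_eq_iff hp _ _ _ _)
  have hprim : ∑ u ∈ (Finset.univ.map F)ᶜ, Nat.card {v // Parallel u v} =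
      (Finset.univ.map F)ᶜ.card * p ^ (n + 1) := by
    rw [← smul_eq_mul]
    refine Finset.sum_eq_card_nsmul fun u hu => ?_
    rw [Finset.mem_compl, hF, not_not] at hu
    obtain ⟨i, hi⟩ := hu
    rw [card_parallel_of_isUnit hi, Nat.card_zmod]
  have hcard := Finset.card_compl_add_card (Finset.univ.map F)
  simp only [Finset.card_map, Finset.card_univ, Fintype.card_fun, ZMod.card, Fintype.card_fin]
    at hcard
  rw [hsum, ← Finset.sum_compl_add_sum (Finset.univ.map F), hnon, hprim, mul_comm 3 (n + 1),
    mul_comm 3 n, pow_mul, pow_mul, ← hcard]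
  ring

end Reduction

theorem tendsto_of_affine_recurrence {a : ℕ → ℝ} {r L : ℝ} (hr0 : 0 ≤ r) (hr1 : r < 1)
    (h : ∀ n, a (n + 1) - L = r * (a n - L)) : Filter.Tendsto a Filter.atTop (nhds L) := by
  have hn : ∀ n, a n = r ^ n * (a 0 - L) + L := by
    intro n
    induction n with
    | zero => simp
    | succ n ih => rw [← sub_eq_iff_eq_add, h, ih]; ring
  rw [funext hn]
  simpa using ((tendsto_pow_atTop_nhds_zero_of_lt_one hr0 hr1).mul_const (a 0 - L)).add_const L

end CommutingTwoByTwo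

open CommutingTwoByTwo in
theorem commuting_2x2_local_density (p : ℕ) (hp : p.Prime) :
    Filter.Tendsto (fun n : ℕ => (matCommCountZMod (p ^ n) : ℝ) / (p : ℝ) ^ (6 * n))
      Filter.atTop
      (nhds ((1 + 1 / (p : ℝ)) * (1 - 1 / (p : ℝ) ^ 2)⁻¹ * (1 - 1 / (p : ℝ) ^ 3))) := by
  have hp1 : (1 : ℝ) < p := by exact_mod_cast hp.one_lt
  have hp0 : (p : ℝ) ≠ 0 := by positivity
  refine tendsto_of_affine_recurrence (r := 1 / p) (by positivity)
    ((div_lt_one (by positivity)).2 hp1) fun n => ?_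
  have hrec : (parallelCount (p ^ (n + 1)) : ℝ) = p ^ (n + 1) * p ^ (3 * (n + 1)) +
      p ^ 3 * parallelCount (p ^ n) - p ^ (n + 1) * p ^ (3 * n) := by
    rw [eq_sub_iff_add_eq]
    exact_mod_cast parallelCount_succ (n := n) hp
  have hL : (1 + 1 / (p : ℝ)) * (1 - 1 / (p : ℝ) ^ 2)⁻¹ = p / (p - 1) := by
    have h1 : (p : ℝ) - 1 ≠ 0 := by linarith
    have h2 : (p : ℝ) ^ 2 - 1 ≠ 0 := by nlinarith
    field_simp
    ring
  have h1 : (p : ℝ) - 1 ≠ 0 := by linarith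
  rw [hL, matCommCountZMod_eq, matCommCountZMod_eq]
  push_cast
  rw [hrec]
  simp only [mul_add, mul_one, pow_add, pow_mul', pow_one]
  have hx : (p : ℝ) ^ n ≠ 0 := pow_ne_zero _ hp0
  generalize (p : ℝ) ^ n = x at *
  field_simp
  ring
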